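/- Define Φ from H-constant n-cochains on A ⋊ H to equivariant cochains by (Φf)(h, a⁰,…,aⁿ) = f(a⁰⊗1, …, a^{n-1}⊗1, aⁿ⊗h). Then Φf satisfies the equivariance condition (Φf)(S(g₍₂₎)hg₍₁₎, a⁰,…,aⁿ) = (Φf)(h, g₍₁₎(a⁰),…,g₍ₙ₊₁₎(aⁿ)) for all g, h ∈ H. -/

import Mathlib

noncomputable section

open TensorProduct

variable {H A : Type} [Ring H] [HopfAlgebra ℂ H] [Ring A] [Algebra ℂ A]

/-- `sweedler N Δ₁ Δ₂ k g F` is the Sweedler sum `Σ F (g₍₁₎, …, g₍ₖ₊₁₎)`, computed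
from a chosen finite representation `comul g = Σ_{i < N g} Δ₁ g i ⊗ Δ₂ g i` of the
comultiplication. -/
def sweedler (N : H → ℕ) (Δ₁ Δ₂ : H → ℕ → H) :
    (k : ℕ) → H → ((Fin (k+1) → H) → ℂ) → ℂ
  | 0, g, F => F ![g]
  | k+1, g, F => ∑ i ∈ Finset.range (N g),
      sweedler N Δ₁ Δ₂ k (Δ₂ g i) (fun v => F (Fin.cons (Δ₁ g i) v))

/-- The multiplication of the crossed product `A ⋊ H`, as a linear map on
`(A ⊗ H) ⊗ (A ⊗ H)`; on pure tensors it is `(a ⊗ h)(b ⊗ g) = a h₍₁₎(b) ⊗ h₍₂₎ g`. -/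
def cpMul (ρ : H →ₗ[ℂ] A →ₗ[ℂ] A) :
    (A ⊗[ℂ] H) ⊗[ℂ] (A ⊗[ℂ] H) →ₗ[ℂ] A ⊗[ℂ] H :=
  (LinearMap.rTensor H (LinearMap.mul' ℂ A)) ∘ₗ
  (TensorProduct.assoc ℂ A A H).symm.toLinearMap ∘ₗ
  (LinearMap.lTensor A (TensorProduct.map (TensorProduct.lift ρ) (LinearMap.mul' ℂ H))) ∘ₗ
  (LinearMap.lTensor A (TensorProduct.tensorTensorTensorComm ℂ H H A H).toLinearMap) ∘ₗ
  (LinearMap.lTensor A (LinearMap.rTensor (A ⊗[ℂ] H) (Coalgebra.comul (R := ℂ)))) ∘ₗ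
  (TensorProduct.assoc ℂ A H (A ⊗[ℂ] H)).toLinearMap

/-- The tuple obtained from `x` by replacing the pair `(xʲ, xʲ⁺¹)` by the single
entry `y` (used with `y = xʲ xʲ⁺¹` for the `j`-th face map). -/
def faceTup {α : Type} {n : ℕ} (j : Fin (n+1)) (y : α) (x : Fin (n+2) → α) :
    Fin (n+1) → α :=
  fun k => if (k : ℕ) < (j : ℕ) then x k.castSucc else if k = j then y else x k.succ

/-- The `i`-th term of the product `(p.1 ⊗ p.2)(q.1 ⊗ q.2)` in `A ⋊ H`, for the chosen
representation of the comultiplication: `p.1 · (Δ₁ p.2 i)(q.1) ⊗ (Δ₂ p.2 i) q.2`. -/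
def cpPairTerm (Δ₁ Δ₂ : H → ℕ → H) (ρ : H →ₗ[ℂ] A →ₗ[ℂ] A) (p q : A × H) (i : ℕ) :
    A × H :=
  (p.1 * ρ (Δ₁ p.2 i) q.1, Δ₂ p.2 i * q.2)

/-- The Hochschild coboundary of a cochain on the crossed product `A ⋊ H`. -/
def cpb (ρ : H →ₗ[ℂ] A →ₗ[ℂ] A) {n : ℕ} (f : (Fin (n+1) → A ⊗[ℂ] H) → ℂ) :
    (Fin (n+2) → A ⊗[ℂ] H) → ℂ := fun x =>
  (∑ j : Fin (n+1), (-1 : ℂ) ^ (j : ℕ) *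
      f (faceTup j (cpMul ρ (x j.castSucc ⊗ₜ[ℂ] x j.succ)) x))
  + (-1 : ℂ) ^ (n+1) *
      f (fun k => if (k : ℕ) = 0 then cpMul ρ (x (Fin.last (n+1)) ⊗ₜ[ℂ] x 0)
                  else x k.castSucc)

/-- `f` vanishes whenever some argument in position `≥ 1` lies in the subalgebra
`1 ⊗ H` of `A ⋊ H`. -/
def HConstVanish {m : ℕ} (f : (Fin m → A ⊗[ℂ] H) → ℂ) : Prop :=
  ∀ x : Fin m → A ⊗[ℂ] H,
    (∃ j : Fin m, 0 < (j : ℕ) ∧ ∃ h : H, x j = (1 : A) ⊗ₜ[ℂ] h) → f x = 0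

/-- An `H`-constant cochain on `A ⋊ H`: both `f` and `bf` vanish whenever some
argument in position `≥ 1` lies in `1 ⊗ H`. -/
def IsHConstant (ρ : H →ₗ[ℂ] A →ₗ[ℂ] A) {n : ℕ}
    (f : MultilinearMap ℂ (fun _ : Fin (n+1) => A ⊗[ℂ] H) ℂ) : Prop :=
  HConstVanish ⇑f ∧ HConstVanish (cpb ρ ⇑f)

/-- Auxiliary recursion for `Ψ`: processes the pairs `x¹, …, xᵏ`, keeping an
accumulated Hopf algebra element `g`; at each step `Δg = g₍₁₎ ⊗ g₍₂₎` is split, the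
current slot becomes `g₍₁₎(aʲ)` and the accumulator becomes `g₍₂₎ hʲ`. -/
def psiAux (N : H → ℕ) (Δ₁ Δ₂ : H → ℕ → H) (ρ : H →ₗ[ℂ] A →ₗ[ℂ] A) :
    (k : ℕ) → H → (Fin k → A × H) → (H → (Fin k → A) → ℂ) → ℂ
  | 0, g, _, F => F g ![]
  | k+1, g, x, F => ∑ i ∈ Finset.range (N g),
      psiAux N Δ₁ Δ₂ ρ k (Δ₂ g i * (x 0).2) (fun j => x j.succ)
        (fun h v => F h (Fin.cons (ρ (Δ₁ g i) (x 0).1) v))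

/-- The value of `Ψφ` on the elementary tensors `a⁰ ⊗ h⁰, …, aⁿ ⊗ hⁿ`:
`Ψ(φ)(a⁰⊗h⁰, …, aⁿ⊗hⁿ) = φ(h⁰₍ₙ₊₁₎ ⋯ h^{n-1}₍₂₎ hⁿ, a⁰, h⁰₍₁₎(a¹), …,
h⁰₍ₙ₎⋯h^{n-1}₍₁₎(aⁿ))`. -/
def psiV (N : H → ℕ) (Δ₁ Δ₂ : H → ℕ → H) (ρ : H →ₗ[ℂ] A →ₗ[ℂ] A) {n : ℕ}
    (φf : H → (Fin (n+1) → A) → ℂ) (x : Fin (n+1) → A × H) : ℂ :=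
  psiAux N Δ₁ Δ₂ ρ n ((x 0).2) (fun j => x j.succ)
    (fun h v => φf h (Fin.cons (x 0).1 v))

/-- The equivariance condition `φ(S(g₍₂₎) h g₍₁₎, a⁰, …, aⁿ) =
φ(h, g₍₁₎(a⁰), …, g₍ₙ₊₁₎(aⁿ))` for a cochain `φ : H ⊗ A^{⊗(n+1)} → ℂ`. -/
def IsEquivariant (N : H → ℕ) (Δ₁ Δ₂ : H → ℕ → H) (ρ : H →ₗ[ℂ] A →ₗ[ℂ] A) {n : ℕ}
    (φf : H → (Fin (n+1) → A) → ℂ) : Prop :=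
  ∀ (g h : H) (a : Fin (n+1) → A),
    sweedler N Δ₁ Δ₂ 1 g
      (fun ℓ => φf (HopfAlgebra.antipode (R := ℂ) (ℓ 1) * h * ℓ 0) a)
      = sweedler N Δ₁ Δ₂ n g (fun ℓ => φf h (fun j => ρ (ℓ j) (a j)))

/-- The cyclic operator on equivariant cochains:
`t φ(h, a⁰, …, aⁿ) = φ(h₍₂₎, S⁻¹(h₍₁₎)(aⁿ), a⁰, …, aⁿ⁻¹)`. -/
def cycOpEq (N : H → ℕ) (Δ₁ Δ₂ : H → ℕ → H) (ρ : H →ₗ[ℂ] A →ₗ[ℂ] A)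
    (Sinv : H →ₗ[ℂ] H) {n : ℕ} (φf : H → (Fin (n+1) → A) → ℂ) :
    H → (Fin (n+1) → A) → ℂ := fun h a =>
  sweedler N Δ₁ Δ₂ 1 h (fun ℓ =>
    φf (ℓ 1) (Fin.cons (ρ (Sinv (ℓ 0)) (a (Fin.last n))) (fun j : Fin n => a j.castSucc)))

/-- The map `Φ`: `(Φf)(h, a⁰, …, aⁿ) = f(a⁰ ⊗ 1, …, aⁿ⁻¹ ⊗ 1, aⁿ ⊗ h)`. -/
def phiV {n : ℕ} (f : MultilinearMap ℂ (fun _ : Fin (n+1) => A ⊗[ℂ] H) ℂ) :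
    H → (Fin (n+1) → A) → ℂ := fun h a =>
  f (fun i => if i = Fin.last n then a i ⊗ₜ[ℂ] h else a i ⊗ₜ[ℂ] (1 : H))


lemma cpMul_right (ρ : H →ₗ[ℂ] A →ₗ[ℂ] A)
    (hact_one : ∀ h : H, ρ h 1 = (Coalgebra.counit (R := ℂ) h) • (1 : A))
    (a : A) (k g : H) :
    cpMul ρ ((a ⊗ₜ[ℂ] k) ⊗ₜ[ℂ] ((1 : A) ⊗ₜ[ℂ] g)) = a ⊗ₜ[ℂ] (k * g) := by
  have key : ∀ z : H ⊗[ℂ] H,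
      (LinearMap.rTensor H (LinearMap.mul' ℂ A)) ((TensorProduct.assoc ℂ A A H).symm
        (a ⊗ₜ[ℂ] (TensorProduct.map (TensorProduct.lift ρ) (LinearMap.mul' ℂ H)
          (TensorProduct.tensorTensorTensorComm ℂ H H A H (z ⊗ₜ[ℂ] ((1 : A) ⊗ₜ[ℂ] g))))))
      = a ⊗ₜ[ℂ] ((TensorProduct.lid ℂ H
          (LinearMap.rTensor H (Coalgebra.counit (R := ℂ)) z)) * g) := by
    intro z
    induction z with
    | zero => simp
    | add u v hu hv => simp only [add_tmul, map_add, tmul_add, hu, hv, add_mul]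
    | tmul p q =>
      simp [hact_one, TensorProduct.smul_tmul]
  have := key (Coalgebra.comul (R := ℂ) k)
  rw [Coalgebra.rTensor_counit_comul] at this
  simpa [cpMul] using this

lemma cpMul_left (N : H → ℕ) (Δ₁ Δ₂ : H → ℕ → H)
    (hrep : ∀ g : H, (Coalgebra.comul (R := ℂ) g : H ⊗[ℂ] H) =
      ∑ i ∈ Finset.range (N g), Δ₁ g i ⊗ₜ[ℂ] Δ₂ g i)
    (ρ : H →ₗ[ℂ] A →ₗ[ℂ] A) (a : A) (k g : H) :
    cpMul ρ (((1 : A) ⊗ₜ[ℂ] g) ⊗ₜ[ℂ] (a ⊗ₜ[ℂ] k)) =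
      ∑ i ∈ Finset.range (N g), ρ (Δ₁ g i) a ⊗ₜ[ℂ] (Δ₂ g i * k) := by
  simp [cpMul, hrep g, sum_tmul, tmul_sum]

lemma coassoc_sum (N : H → ℕ) (Δ₁ Δ₂ : H → ℕ → H)
    (hrep : ∀ g : H, (Coalgebra.comul (R := ℂ) g : H ⊗[ℂ] H) =
      ∑ i ∈ Finset.range (N g), Δ₁ g i ⊗ₜ[ℂ] Δ₂ g i) (g : H) :
    ∑ i ∈ Finset.range (N g), ∑ k ∈ Finset.range (N (Δ₁ g i)),
      (Δ₁ (Δ₁ g i) k ⊗ₜ[ℂ] Δ₂ (Δ₁ g i) k) ⊗ₜ[ℂ] Δ₂ g i =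
    ∑ i ∈ Finset.range (N g), ∑ k ∈ Finset.range (N (Δ₂ g i)),
      (Δ₁ g i ⊗ₜ[ℂ] Δ₁ (Δ₂ g i) k) ⊗ₜ[ℂ] Δ₂ (Δ₂ g i) k := by
  have h := Coalgebra.coassoc_symm_apply (R := ℂ) g
  rw [hrep g] at h
  simpa [hrep, sum_tmul, tmul_sum] using h.symm

lemma antipode_sum (N : H → ℕ) (Δ₁ Δ₂ : H → ℕ → H)
    (hrep : ∀ g : H, (Coalgebra.comul (R := ℂ) g : H ⊗[ℂ] H) =
      ∑ i ∈ Finset.range (N g), Δ₁ g i ⊗ₜ[ℂ] Δ₂ g i)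
    (ρ : H →ₗ[ℂ] A →ₗ[ℂ] A) (a : A) (g h : H) :
    ∑ i ∈ Finset.range (N g), cpMul ρ (((1 : A) ⊗ₜ[ℂ] (Δ₁ g i)) ⊗ₜ[ℂ]
      (a ⊗ₜ[ℂ] (HopfAlgebra.antipode ℂ (Δ₂ g i) * h))) = ρ g a ⊗ₜ[ℂ] h := by
  simp only [cpMul_left N Δ₁ Δ₂ hrep]
  let T : (H ⊗[ℂ] H) ⊗[ℂ] H →ₗ[ℂ] A ⊗[ℂ] H :=
    (TensorProduct.map (ρ.flip a) (LinearMap.mulRight ℂ h ∘ₗ LinearMap.mul' ℂ H ∘ₗ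
      LinearMap.lTensor H (HopfAlgebra.antipode ℂ))) ∘ₗ
      (TensorProduct.assoc ℂ H H H).toLinearMap
  have h1 := congrArg T (coassoc_sum N Δ₁ Δ₂ hrep g)
  simp only [map_sum] at h1
  have hT : ∀ p q r : H, T ((p ⊗ₜ[ℂ] q) ⊗ₜ[ℂ] r) =
      ρ p a ⊗ₜ[ℂ] (q * (HopfAlgebra.antipode ℂ r * h)) := by
    intro p q r; simp [T, mul_assoc]
  simp only [hT] at h1
  rw [h1]
  have h2 : ∀ y : H, ∑ k ∈ Finset.range (N y),
      Δ₁ y k * (HopfAlgebra.antipode ℂ (Δ₂ y k) * h) =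
        (Coalgebra.counit (R := ℂ) y) • h := by
    intro y
    have := HopfAlgebra.mul_antipode_lTensor_comul_apply (R := ℂ) y
    rw [hrep y] at this
    simp only [map_sum, LinearMap.lTensor_tmul, LinearMap.mul'_apply] at this
    simp only [← mul_assoc, ← Finset.sum_mul, this, Algebra.smul_def]
  simp only [← tmul_sum, h2]
  have h3 := Coalgebra.lTensor_counit_comul (R := ℂ) g
  rw [hrep g] at h3
  have h4 := congrArg (fun z => TensorProduct.rid ℂ H z) h3
  simp only [map_sum, LinearMap.lTensor_tmul, TensorProduct.rid_tmul, one_smul] at h4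
  conv_rhs => rw [← h4]
  simp only [map_sum, LinearMap.sum_apply, sum_tmul, map_smul, LinearMap.smul_apply,
    smul_tmul]

def tupH {m : ℕ} (a : Fin (m+1) → A) (u : H) : Fin (m+1) → A ⊗[ℂ] H :=
  fun i => if i = Fin.last m then a i ⊗ₜ[ℂ] u else a i ⊗ₜ[ℂ] (1 : H)

lemma tupH_succ {m : ℕ} (a : Fin (m+2) → A) (u : H) :
    tupH a u = Fin.cons (a 0 ⊗ₜ[ℂ] (1 : H)) (tupH (fun j => a j.succ) u) := by
  funext i
  refine Fin.cases ?_ (fun j => ?_) i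
  · simp [tupH, Fin.ext_iff]
  · simp [tupH, Fin.ext_iff]

lemma tupH_update {m : ℕ} (a : Fin (m+1) → A) (u : H) :
    tupH a u = Function.update (tupH a (0 : H)) (Fin.last m) (a (Fin.last m) ⊗ₜ[ℂ] u) := by
  funext i
  by_cases hi : i = Fin.last m
  · subst hi; simp [tupH]
  · simp [tupH, hi]

def SlideH (ρ : H →ₗ[ℂ] A →ₗ[ℂ] A) {m : ℕ}
    (f : MultilinearMap ℂ (fun _ : Fin (m+1) => A ⊗[ℂ] H) ℂ) : Prop :=
  ∀ (j : Fin m) (x : Fin (m+1) → A ⊗[ℂ] H) (g : H),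
    f (Function.update x j.castSucc (cpMul ρ (x j.castSucc ⊗ₜ[ℂ] ((1 : A) ⊗ₜ[ℂ] g)))) =
    f (Function.update x j.succ (cpMul ρ (((1 : A) ⊗ₜ[ℂ] g) ⊗ₜ[ℂ] x j.succ)))

lemma SlideH.curry (ρ : H →ₗ[ℂ] A →ₗ[ℂ] A) {m : ℕ}
    (f : MultilinearMap ℂ (fun _ : Fin (m+2) => A ⊗[ℂ] H) ℂ) (hf : SlideH ρ f)
    (y : A ⊗[ℂ] H) : SlideH ρ (m := m) (f.curryLeft y) := by
  intro j x g
  have := hf j.succ (Fin.cons y x) g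
  rw [← Fin.succ_castSucc, Fin.cons_succ, Fin.cons_succ, ← Fin.cons_update,
    ← Fin.cons_update] at this
  simpa using this

lemma main_aux (N : H → ℕ) (Δ₁ Δ₂ : H → ℕ → H)
    (hrep : ∀ g : H, (Coalgebra.comul (R := ℂ) g : H ⊗[ℂ] H) =
      ∑ i ∈ Finset.range (N g), Δ₁ g i ⊗ₜ[ℂ] Δ₂ g i)
    (ρ : H →ₗ[ℂ] A →ₗ[ℂ] A)
    (hact_one : ∀ h : H, ρ h 1 = (Coalgebra.counit (R := ℂ) h) • (1 : A)) (h : H) :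
    ∀ (m : ℕ) (f : MultilinearMap ℂ (fun _ : Fin (m+1) => A ⊗[ℂ] H) ℂ), SlideH ρ f →
    ∀ (g : H) (a : Fin (m+1) → A),
    ∑ i ∈ Finset.range (N g),
      f (Function.update (tupH a (HopfAlgebra.antipode ℂ (Δ₂ g i) * h)) 0
        (cpMul ρ (((1 : A) ⊗ₜ[ℂ] (Δ₁ g i)) ⊗ₜ[ℂ]
          (tupH a (HopfAlgebra.antipode ℂ (Δ₂ g i) * h) 0)))) =
    sweedler N Δ₁ Δ₂ m g (fun ℓ => f (tupH (fun j => ρ (ℓ j) (a j)) h)) := by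
  intro m
  induction m with
  | zero =>
    intro f _ g a
    have e : ∀ (x : Fin 1 → A ⊗[ℂ] H) (y : A ⊗[ℂ] H),
        Function.update x 0 y = Function.update (fun _ => (0 : A ⊗[ℂ] H)) 0 y := by
      intro x y; funext i; fin_cases i; simp
    simp only [e (tupH a _)]
    rw [← MultilinearMap.map_update_sum]
    have t0 : ∀ u : H, tupH a u 0 = a 0 ⊗ₜ[ℂ] u := by intro u; simp [tupH]
    simp only [t0]
    rw [antipode_sum N Δ₁ Δ₂ hrep]
    simp only [sweedler]
    congr 1
    funext i; fin_cases i; simp [tupH]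
  | succ m ih =>
    intro f hf g a
    simp only [sweedler]
    set b : Fin (m+1) → A := fun j => a j.succ with hb
    have step : ∀ i, sweedler N Δ₁ Δ₂ m (Δ₂ g i) (fun v => f (tupH
        (fun j => ρ ((Fin.cons (Δ₁ g i) v : Fin (m+2) → H) j) (a j)) h)) =
        ∑ k ∈ Finset.range (N (Δ₂ g i)),
          f (Fin.cons (ρ (Δ₁ g i) (a 0) ⊗ₜ[ℂ] Δ₁ (Δ₂ g i) k)
            (tupH b (HopfAlgebra.antipode ℂ (Δ₂ (Δ₂ g i) k) * h))) := by
      intro i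
      have := ih (f.curryLeft (ρ (Δ₁ g i) (a 0) ⊗ₜ[ℂ] 1)) (SlideH.curry ρ f hf _) (Δ₂ g i) b
      simp only [MultilinearMap.curryLeft_apply] at this
      simp only [tupH_succ, Fin.cons_zero, Fin.cons_succ]
      rw [← this]
      refine Finset.sum_congr rfl fun k _ => ?_
      have s := hf 0 (Fin.cons (ρ (Δ₁ g i) (a 0) ⊗ₜ[ℂ] 1)
        (tupH b (HopfAlgebra.antipode ℂ (Δ₂ (Δ₂ g i) k) * h))) (Δ₁ (Δ₂ g i) k)
      rw [Fin.cons_succ, ← Fin.cons_update, Fin.castSucc_zero, Fin.cons_zero,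
        Fin.update_cons_zero, cpMul_right ρ hact_one, one_mul] at s
      exact s.symm
    simp only [step]
    let B : (A ⊗[ℂ] H) →ₗ[ℂ] (A ⊗[ℂ] H) →ₗ[ℂ] ℂ :=
      LinearMap.mk₂ ℂ (fun y z => f.curryLeft y (Function.update (tupH b (0 : H)) (Fin.last m) z))
        (by intros; rw [map_add]; rfl) (by intros; rw [map_smul]; rfl)
        (by intros; rw [MultilinearMap.map_update_add])
        (by intros; rw [MultilinearMap.map_update_smul])
    have hB : ∀ y u, B y (b (Fin.last m) ⊗ₜ[ℂ] u) = f (Fin.cons y (tupH b u)) := by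
      intro y u
      rw [tupH_update b u]; rfl
    let T : (H ⊗[ℂ] H) ⊗[ℂ] H →ₗ[ℂ] ℂ := TensorProduct.lift B ∘ₗ
      TensorProduct.map (TensorProduct.map (ρ.flip (a 0)) LinearMap.id)
        (TensorProduct.mk ℂ A H (b (Fin.last m)) ∘ₗ LinearMap.mulRight ℂ h ∘ₗ
          HopfAlgebra.antipode ℂ)
    have hT : ∀ p q r : H, T ((p ⊗ₜ[ℂ] q) ⊗ₜ[ℂ] r) =
        f (Fin.cons (ρ p (a 0) ⊗ₜ[ℂ] q) (tupH b (HopfAlgebra.antipode ℂ r * h))) := by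
      intro p q r; simp [T, hB]
    have h1 := congrArg T (coassoc_sum N Δ₁ Δ₂ hrep g)
    simp only [map_sum, hT] at h1
    rw [← h1]
    refine Finset.sum_congr rfl fun i _ => ?_
    rw [tupH_succ, Fin.cons_zero, Fin.update_cons_zero, cpMul_left N Δ₁ Δ₂ hrep, ← hb, ← hB,
      map_sum, LinearMap.sum_apply]
    simp only [hB, mul_one]

def insH {n : ℕ} (p : ℕ) (e : A ⊗[ℂ] H) (x : Fin (n+1) → A ⊗[ℂ] H) : Fin (n+2) → A ⊗[ℂ] H :=
  fun k => if (k : ℕ) ≤ p then x ⟨min k n, by omega⟩ else if (k : ℕ) = p + 1 then e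
    else x ⟨(k : ℕ) - 1, by omega⟩

lemma slide_inner (ρ : H →ₗ[ℂ] A →ₗ[ℂ] A) {n : ℕ}
    (f : MultilinearMap ℂ (fun _ : Fin (n+1) => A ⊗[ℂ] H) ℂ)
    (hf : IsHConstant ρ f) : SlideH ρ f := by
  intro j x g
  obtain ⟨h1, h2⟩ := hf
  have hy : ∀ k : Fin (n+2), (k : ℕ) = j + 1 →
      insH (j : ℕ) ((1 : A) ⊗ₜ[ℂ] g) x k = (1 : A) ⊗ₜ[ℂ] g := by
    intro k hk; simp [insH, hk]
  have hlo : ∀ (k : Fin (n+2)) (l : Fin (n+1)), (k : ℕ) ≤ j → (l : ℕ) = k →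
      insH (j : ℕ) ((1 : A) ⊗ₜ[ℂ] g) x k = x l := by
    intro k l hk hl; simp only [insH, hk, if_true]; congr 1; ext; simp; omega
  have hhi : ∀ (k : Fin (n+2)) (l : Fin (n+1)), (j : ℕ) + 1 < k → (l : ℕ) + 1 = k →
      insH (j : ℕ) ((1 : A) ⊗ₜ[ℂ] g) x k = x l := by
    intro k l hk hl
    simp only [insH]
    rw [if_neg (by omega), if_neg (by omega)]; congr 1; ext; simp; omega
  set y := insH (j : ℕ) ((1 : A) ⊗ₜ[ℂ] g) x with hydef
  have h3 := h2 y ⟨j.succ.castSucc, by simp, g, hy _ (by simp)⟩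
  unfold cpb at h3
  rw [h1 (fun k : Fin (n+1) => if (k : ℕ) = 0 then _ else y k.castSucc)
    ⟨j.succ, by simp, g, by simpa using hy j.succ.castSucc (by simp)⟩, mul_zero, add_zero] at h3
  have hne : j.castSucc ≠ j.succ := by simp [Fin.ext_iff]
  rw [Finset.sum_eq_add_of_mem j.castSucc j.succ (Finset.mem_univ _) (Finset.mem_univ _) hne] at h3
  · have e1 : faceTup j.castSucc (cpMul ρ (y j.castSucc.castSucc ⊗ₜ[ℂ] y j.castSucc.succ)) y =
        Function.update x j.castSucc (cpMul ρ (x j.castSucc ⊗ₜ[ℂ] ((1 : A) ⊗ₜ[ℂ] g))) := by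
      funext k
      rw [hlo j.castSucc.castSucc j.castSucc (by simp) (by simp), hy j.castSucc.succ (by simp)]
      by_cases hk : k = j.castSucc
      · subst hk; simp [faceTup]
      · rw [Function.update_of_ne hk]
        have hk' : (k : ℕ) ≠ j := fun q => hk (Fin.ext q)
        simp only [faceTup, hk, if_false]
        split_ifs with q
        · exact hlo _ _ (by simp at q ⊢; omega) (by simp)
        · exact hhi _ _ (by simp at q ⊢; omega) (by simp)
    have e2 : faceTup j.succ (cpMul ρ (y j.succ.castSucc ⊗ₜ[ℂ] y j.succ.succ)) y =
        Function.update x j.succ (cpMul ρ (((1 : A) ⊗ₜ[ℂ] g) ⊗ₜ[ℂ] x j.succ)) := by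
      funext k
      rw [hhi j.succ.succ j.succ (by simp) (by simp), hy j.succ.castSucc (by simp)]
      by_cases hk : k = j.succ
      · subst hk; simp [faceTup]
      · rw [Function.update_of_ne hk]
        have hk' : (k : ℕ) ≠ j + 1 := fun q => hk (Fin.ext (by simpa using q))
        simp only [faceTup, hk, if_false]
        split_ifs with q
        · exact hlo _ _ (by simp at q ⊢; omega) (by simp)
        · exact hhi _ _ (by simp at q ⊢; omega) (by simp)
    rw [e1, e2] at h3
    have hs : ((-1 : ℂ) ^ (j : ℕ)) ≠ 0 := by simp
    simp only [Fin.val_castSucc, Fin.val_succ, pow_succ] at h3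
    apply mul_left_cancel₀ hs
    linear_combination h3
  · intro i _ hi
    have i1 : (i : ℕ) ≠ j := fun q => hi.1 (Fin.ext q)
    have i2 : (i : ℕ) ≠ j + 1 := fun q => hi.2 (Fin.ext (by simpa using q))
    rw [h1, mul_zero]
    rcases lt_or_ge (i : ℕ) j with q | q
    · refine ⟨j.castSucc, by simp; omega, g, ?_⟩
      simp only [faceTup, Fin.val_castSucc]
      rw [if_neg (by omega), if_neg (fun q => i1 (by rw [← q]; simp))]
      exact hy _ (by simp)
    · refine ⟨j.succ, by simp, g, ?_⟩
      simp only [faceTup, Fin.val_succ]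
      rw [if_pos (by omega)]
      exact hy _ (by simp)

lemma slide_cyc (ρ : H →ₗ[ℂ] A →ₗ[ℂ] A) {n : ℕ}
    (f : MultilinearMap ℂ (fun _ : Fin (n+1) => A ⊗[ℂ] H) ℂ)
    (hf : IsHConstant ρ f) (x : Fin (n+1) → A ⊗[ℂ] H) (g : H) :
    f (Function.update x (Fin.last n) (cpMul ρ (x (Fin.last n) ⊗ₜ[ℂ] ((1 : A) ⊗ₜ[ℂ] g)))) =
    f (Function.update x 0 (cpMul ρ (((1 : A) ⊗ₜ[ℂ] g) ⊗ₜ[ℂ] x 0))) := by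
  obtain ⟨h1, h2⟩ := hf
  let y : Fin (n+2) → A ⊗[ℂ] H := Fin.snoc (α := fun _ => A ⊗[ℂ] H) x ((1 : A) ⊗ₜ[ℂ] g)
  have yl : y (Fin.last (n+1)) = (1 : A) ⊗ₜ[ℂ] g := by simp [y]
  have yc : ∀ k : Fin (n+1), y k.castSucc = x k := by intro k; simp [y]
  have h3 := h2 y ⟨Fin.last (n+1), by simp, g, yl⟩
  unfold cpb at h3
  rw [Finset.sum_eq_single_of_mem (Fin.last n) (Finset.mem_univ _)] at h3
  · have e1 : faceTup (Fin.last n) (cpMul ρ (y (Fin.last n).castSucc ⊗ₜ[ℂ] y (Fin.last n).succ)) y =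
        Function.update x (Fin.last n)
          (cpMul ρ (x (Fin.last n) ⊗ₜ[ℂ] ((1 : A) ⊗ₜ[ℂ] g))) := by
      funext k
      rw [yc, Fin.succ_last, yl]
      by_cases hk : k = Fin.last n
      · subst hk; simp [faceTup]
      · rw [Function.update_of_ne hk]
        have : (k : ℕ) < n := by
          have := Fin.lt_last_iff_ne_last.2 hk
          simpa [Fin.lt_def] using this
        simp [faceTup, this, yc]
    have e2 : (fun k : Fin (n+1) => if (k : ℕ) = 0 then cpMul ρ (y (Fin.last (n+1)) ⊗ₜ[ℂ] y 0)
        else y k.castSucc) =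
        Function.update x 0 (cpMul ρ (((1 : A) ⊗ₜ[ℂ] g) ⊗ₜ[ℂ] x 0)) := by
      funext k
      rw [yl, yc, show y 0 = x 0 from yc 0]
      by_cases hk : k = 0
      · subst hk; simp
      · rw [Function.update_of_ne hk, if_neg (fun q : (k : ℕ) = 0 => hk (Fin.ext q))]
    rw [e1, e2] at h3
    have hs : ((-1 : ℂ) ^ n) ≠ 0 := by simp
    simp only [Fin.val_last, pow_succ] at h3
    apply mul_left_cancel₀ hs
    linear_combination h3
  · intro i _ hi
    have : (i : ℕ) < n := by
      have := Fin.lt_last_iff_ne_last.2 hi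
      simpa [Fin.lt_def] using this
    rw [h1, mul_zero]
    refine ⟨Fin.last n, by simp; omega, g, ?_⟩
    simp only [faceTup, Fin.val_last]
    rw [if_neg (by omega), if_neg (fun q => hi q.symm), Fin.succ_last, yl]

/-- If `f` is an `H`-constant `n`-cochain on `A ⋊ H`, then
`(Φf)(h, a⁰,…,aⁿ) = f(a⁰ ⊗ 1, …, aⁿ⁻¹ ⊗ 1, aⁿ ⊗ h)` satisfies the equivariance
condition `(Φf)(S(g₍₂₎)hg₍₁₎, a⁰,…,aⁿ) = (Φf)(h, g₍₁₎(a⁰),…,g₍ₙ₊₁₎(aⁿ))`. -/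
theorem statement15 {n : ℕ}
    (N : H → ℕ) (Δ₁ Δ₂ : H → ℕ → H)
    (hrep : ∀ g : H, (Coalgebra.comul (R := ℂ) g : H ⊗[ℂ] H) =
      ∑ i ∈ Finset.range (N g), Δ₁ g i ⊗ₜ[ℂ] Δ₂ g i)
    (ρ : H →ₗ[ℂ] A →ₗ[ℂ] A)
    (hρ_one : ρ 1 = LinearMap.id)
    (hρ_mul : ∀ g h : H, ρ (g * h) = ρ g ∘ₗ ρ h)
    (hact_mul : ∀ (h : H) (a b : A),
      ρ h (a * b) = ∑ i ∈ Finset.range (N h), ρ (Δ₁ h i) a * ρ (Δ₂ h i) b)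
    (hact_one : ∀ h : H, ρ h 1 = (Coalgebra.counit (R := ℂ) h) • (1 : A))
    (f : MultilinearMap ℂ (fun _ : Fin (n+1) => A ⊗[ℂ] H) ℂ)
    (hf : IsHConstant ρ f) :
    IsEquivariant N Δ₁ Δ₂ ρ (phiV f) := by
  intro g h a
  have hm := main_aux N Δ₁ Δ₂ hrep ρ hact_one h n f (slide_inner ρ f hf) g a
  have hphi : ∀ (u : H) (b : Fin (n+1) → A), phiV f u b = f (tupH b u) := fun _ _ => rfl
  simp only [hphi]
  rw [← hm]
  simp only [sweedler]
  refine Finset.sum_congr rfl fun i _ => ?_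
  rw [← slide_cyc ρ f hf]
  simp only [Fin.cons_zero, Fin.cons_one, Matrix.cons_val_fin_one]
  congr 1
  have tl : ∀ u : H, tupH a u (Fin.last n) = a (Fin.last n) ⊗ₜ[ℂ] u := by
    intro u; simp [tupH]
  rw [tl, cpMul_right ρ hact_one, tupH_update a, tupH_update a (_ * h), Function.update_idem]

end
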